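/- Let ℱ = (F_n)_{n∈ℕ} be a left Følner sequence of nonempty finite subsets of ℚ (under addition), and let A ⊆ ℚ with d̄_ℱ(A) > 0. Then for each k ∈ ℕ there exist a nonzero INTEGER q and p ∈ A such that p + jq ∈ A for every 0 ≤ j ≤ k. -/

import Mathlib

open scoped symmDiff

/-- `(F_n)` is a left Følner sequence of nonempty finite subsets of `ℚ`. -/
def IsLeftFolner (F : ℕ → Finset ℚ) : Prop :=
  (∀ n, (F n).Nonempty) ∧
    ∀ s : ℚ, Filter.Tendsto
      (fun n => ((((F n).image (s + ·)) ∆ (F n)).card : ℝ) / (F n).card)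
      Filter.atTop (nhds 0)

/-- The upper density `d̄_ℱ(A) = limsup_n |A ∩ F_n| / |F_n|`. -/
noncomputable def upperDensity (F : ℕ → Finset ℚ) (A : Set ℚ) : ℝ :=
  Filter.limsup (fun n => (Set.ncard (A ∩ ↑(F n)) : ℝ) / (F n).card) Filter.atTop

namespace DHJ

/-- Indicator of a proposition. -/
noncomputable def ind (p : Prop) : ℝ := open Classical in if p then 1 else 0

lemma ind_true {p : Prop} (h : p) : ind p = 1 := by simp [ind, h]
lemma ind_false {p : Prop} (h : ¬ p) : ind p = 0 := by simp [ind, h]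
lemma ind_nonneg (p : Prop) : 0 ≤ ind p := by unfold ind; split_ifs <;> norm_num
lemma ind_le_one (p : Prop) : ind p ≤ 1 := by unfold ind; split_ifs <;> norm_num
lemma ind_mono {p q : Prop} (h : p → q) : ind p ≤ ind q := by
  by_cases hp : p
  · rw [ind_true hp, ind_true (h hp)]
  · rw [ind_false hp]; exact ind_nonneg q
lemma ind_congr {p q : Prop} (h : p ↔ q) : ind p = ind q := by rw [propext h]

/-- Average of a function over a finite type. -/
noncomputable def av {X : Type*} [Finite X] (f : X → ℝ) : ℝ :=
  letI := Fintype.ofFinite X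
  (∑ x, f x) / Nat.card X

lemma av_eq {X : Type*} [Fintype X] (f : X → ℝ) : av f = (∑ x, f x) / Fintype.card X := by
  unfold av
  simp only [Nat.card_eq_fintype_card]
  congr!

section
variable {X Y : Type*} [Finite X] [Finite Y]

lemma av_mono {f g : X → ℝ} (h : ∀ x, f x ≤ g x) : av f ≤ av g := by
  have := Fintype.ofFinite X
  rw [av_eq, av_eq]
  gcongr with x
  exact h x

lemma av_congr {f g : X → ℝ} (h : ∀ x, f x = g x) : av f = av g := by
  rw [funext h]

lemma av_add (f g : X → ℝ) : av (fun x => f x + g x) = av f + av g := by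
  have := Fintype.ofFinite X
  rw [av_eq, av_eq, av_eq, Finset.sum_add_distrib, add_div]

lemma av_sub (f g : X → ℝ) : av (fun x => f x - g x) = av f - av g := by
  have := Fintype.ofFinite X
  rw [av_eq, av_eq, av_eq, Finset.sum_sub_distrib, sub_div]

lemma av_mul (c : ℝ) (f : X → ℝ) : av (fun x => c * f x) = c * av f := by
  have := Fintype.ofFinite X
  rw [av_eq, av_eq, ← Finset.mul_sum, mul_div_assoc]

lemma av_const [Nonempty X] (c : ℝ) : av (fun _ : X => c) = c := by
  have := Fintype.ofFinite X
  rw [av_eq]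
  simp

lemma av_nonneg {f : X → ℝ} (h : ∀ x, 0 ≤ f x) : 0 ≤ av f := by
  have := Fintype.ofFinite X
  rw [av_eq]
  exact div_nonneg (Finset.sum_nonneg fun x _ => h x) (by positivity)

lemma av_le [Nonempty X] {f : X → ℝ} {c : ℝ} (h : ∀ x, f x ≤ c) : av f ≤ c :=
  (av_mono h).trans_eq (av_const c)

lemma le_av [Nonempty X] {f : X → ℝ} {c : ℝ} (h : ∀ x, c ≤ f x) : c ≤ av f :=
  (av_const c).symm.trans_le (av_mono h)

lemma exists_le_of_le_av [Nonempty X] {f : X → ℝ} {c : ℝ} (h : c ≤ av f) : ∃ x, c ≤ f x := by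
  by_contra! hc
  have := Fintype.ofFinite X
  rw [av_eq, le_div_iff₀ (by positivity)] at h
  have : ∑ x, f x < ∑ _x : X, c := Finset.sum_lt_sum_of_nonempty Finset.univ_nonempty
    fun x _ => hc x
  simp at this
  linarith

lemma av_prod (f : X × Y → ℝ) : av f = av (fun x => av fun y => f (x, y)) := by
  have := Fintype.ofFinite X
  have := Fintype.ofFinite Y
  simp only [av_eq]
  rw [Fintype.sum_prod_type, ← Finset.sum_div, Fintype.card_prod, div_div]
  push_cast
  rw [mul_comm]

lemma av_equiv (e : X ≃ Y) (f : Y → ℝ) : av (fun x => f (e x)) = av f := by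
  have := Fintype.ofFinite X
  have := Fintype.ofFinite Y
  simp only [av_eq]
  rw [Equiv.sum_comp e f, Fintype.card_congr e]

lemma av_comm (f : X → Y → ℝ) : av (fun x => av fun y => f x y) = av fun y => av fun x => f x y := by
  rw [← av_prod (fun p : X × Y => f p.1 p.2), ← av_prod (fun p : Y × X => f p.2 p.1),
    ← av_equiv (Equiv.prodComm X Y)]
  rfl

lemma av_sum {W : Type*} (s : Finset W) (f : W → X → ℝ) :
    av (fun x => ∑ w ∈ s, f w x) = ∑ w ∈ s, av (f w) := by
  have := Fintype.ofFinite X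
  simp only [av_eq]
  rw [Finset.sum_comm, Finset.sum_div]

lemma sum_eq_card_mul_av [Fintype Y] (f : Y → ℝ) [Nonempty Y] :
    ∑ y, f y = Fintype.card Y * av f := by
  rw [av_eq]; field_simp

lemma markov [Nonempty X] {g : X → ℝ} {d : ℝ} (hg : ∀ x, g x ≤ 1) (hd : d ≤ av g) (hd0 : 0 ≤ d) :
    d / 2 ≤ av (fun x => ind (d / 2 ≤ g x)) := by
  have : av g ≤ av (fun x => d / 2 + ind (d / 2 ≤ g x)) := by
    apply av_mono
    intro x
    by_cases h : d / 2 ≤ g x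
    · rw [ind_true h]; linarith [hg x]
    · rw [ind_false h]; linarith
  rw [av_add, av_const] at this
  linarith

/-- pigeonhole -/
lemma pigeon {W : Type*} [Finite W] [Nonempty X] [Nonempty W] {p : X → Prop} {q : W → X → Prop}
    (h : ∀ x, p x → ∃ w, q w x) :
    ∃ w, av (fun x => ind (p x)) / Nat.card W ≤ av fun x => ind (q w x) := by
  have := Fintype.ofFinite W
  have h1 : av (fun x => ind (p x)) ≤ av (fun x => ∑ w, ind (q w x)) := by
    apply av_mono
    intro x
    by_cases hx : p x
    · obtain ⟨w, hw⟩ := h x hx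
      rw [ind_true hx, ← ind_true hw]
      exact Finset.single_le_sum (f := fun w => ind (q w x)) (fun i _ => ind_nonneg _)
        (Finset.mem_univ w)
    · rw [ind_false hx]
      exact Finset.sum_nonneg fun i _ => ind_nonneg _
  rw [av_sum, sum_eq_card_mul_av] at h1
  apply exists_le_of_le_av
  rw [Nat.card_eq_fintype_card, div_le_iff₀ (by positivity)]
  linarith

end

/-- Glue two words along a splitting of the index set. -/
def glue {ι T R β : Type*} (e : ι ≃ T ⊕ R) (t : T → β) (x : R → β) : ι → β :=
  fun i => Sum.elim t x (e i)

lemma av_glue {ι T R β : Type*} [Finite ι] [Finite T] [Finite R] [Finite β] (e : ι ≃ T ⊕ R)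
    (f : (ι → β) → ℝ) : av f = av fun t => av fun x => f (glue e t x) := by
  rw [← av_prod (fun p : (T → β) × (R → β) => f (glue e p.1 p.2)),
    ← av_equiv ((e.arrowCongr (Equiv.refl β)).trans (Equiv.sumArrowEquivProdArrow T R β))]
  apply av_congr
  intro x
  congr 1
  ext i
  have h2 : ∀ s : T ⊕ R, x (e.symm s) = Sum.elim (fun j => x (e.symm (Sum.inl j)))
      (fun j => x (e.symm (Sum.inr j))) s := by
    rintro (j | j) <;> rfl
  have h3 := h2 (e i)
  rw [Equiv.symm_apply_apply] at h3
  exact h3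

lemma exists_split {ι T : Type} [Finite ι] [Finite T] {N : ℕ} (h : Nat.card T + N ≤ Nat.card ι) :
    ∃ r, N ≤ r ∧ Nonempty (ι ≃ T ⊕ Fin r) := by
  refine ⟨Nat.card ι - Nat.card T, by omega, Finite.card_eq.mp ?_⟩
  simp [Nat.card_sum]
  omega

/-- Combinatorial subspaces, as maps. -/
def IsSub {η ι β : Type*} (φ : (η → β) → ι → β) : Prop :=
  (∀ i, (∃ c, ∀ y, φ y i = c) ∨ ∃ j, ∀ y, φ y i = y j) ∧ ∀ j, ∃ i, ∀ y, φ y i = y j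

section
variable {η κ ι T R β : Type*}

lemma IsSub.comp {φ : (κ → β) → ι → β} {ψ : (η → β) → κ → β} (hφ : IsSub φ) (hψ : IsSub ψ) :
    IsSub (fun y => φ (ψ y)) := by
  constructor
  · intro i
    rcases hφ.1 i with ⟨c, hc⟩ | ⟨j, hj⟩
    · exact Or.inl ⟨c, fun y => hc _⟩
    · rcases hψ.1 j with ⟨c, hc⟩ | ⟨l, hl⟩
      · exact Or.inl ⟨c, fun y => (hj _).trans (hc y)⟩
      · exact Or.inr ⟨l, fun y => (hj _).trans (hl y)⟩
  · intro j
    obtain ⟨i, hi⟩ := hψ.2 j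
    obtain ⟨l, hl⟩ := hφ.2 i
    exact ⟨l, fun y => (hl _).trans (hi y)⟩

lemma IsSub.injective {φ : (κ → β) → ι → β} (hφ : IsSub φ) : Function.Injective φ := by
  intro y z h
  ext j
  obtain ⟨i, hi⟩ := hφ.2 j
  rw [← hi y, ← hi z, h]

lemma isSub_glue_right (e : ι ≃ T ⊕ R) (t : T → β) : IsSub (fun x : R → β => glue e t x) := by
  constructor
  · intro i
    rcases h : e i with j | j
    · exact Or.inl ⟨t j, fun y => by simp [glue, h]⟩
    · exact Or.inr ⟨j, fun y => by simp [glue, h]⟩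
  · intro j
    exact ⟨e.symm (Sum.inr j), fun y => by simp [glue]⟩

lemma isSub_glue_left (e : ι ≃ T ⊕ R) (x : R → β) : IsSub (fun t : T → β => glue e t x) := by
  constructor
  · intro i
    rcases h : e i with j | j
    · exact Or.inr ⟨j, fun y => by simp [glue, h]⟩
    · exact Or.inl ⟨x j, fun y => by simp [glue, h]⟩
  · intro j
    exact ⟨e.symm (Sum.inl j), fun y => by simp [glue]⟩

end

/-- `A` contains a combinatorial line. -/
def HasLine {ι α : Type*} (A : Set (ι → α)) : Prop :=
  ∃ w : ι → Option α, (∃ i, w i = none) ∧ ∀ a, (fun i => (w i).getD a) ∈ A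

/-- density -/
noncomputable def dens {X : Type*} [Finite X] (A : Set X) : ℝ := av fun x => ind (x ∈ A)

lemma dens_nonneg {X : Type*} [Finite X] (A : Set X) : 0 ≤ dens A :=
  av_nonneg fun _ => ind_nonneg _

lemma dens_le_one {X : Type*} [Finite X] [Nonempty X] (A : Set X) : dens A ≤ 1 :=
  av_le fun _ => ind_le_one _

/-- Density Hales-Jewett at a given density. -/
def DHJAt (α : Type) [Finite α] (d : ℝ) : Prop :=
  ∃ N : ℕ, ∀ (ι : Type) [Finite ι], N ≤ Nat.card ι → ∀ A : Set (ι → α), d ≤ dens A → HasLine A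

lemma HasLine.of_sub {η ι α : Type*} {φ : (η → α) → ι → α} (hφ : IsSub φ) {A : Set (ι → α)}
    (h : HasLine (φ ⁻¹' A)) : HasLine A := by
  obtain ⟨w, ⟨j, hj⟩, hw⟩ := h
  have key : ∀ i, ∃ o : Option α, (∀ a, φ (fun j => (w j).getD a) i = o.getD a) ∧
      ((∀ y, φ y i = y j) → o = none) := by
    intro i
    by_cases h0 : ∀ y, φ y i = y j
    · exact ⟨none, fun a => by rw [h0, hj], fun _ => rfl⟩
    · rcases hφ.1 i with ⟨c, hc⟩ | ⟨l, hl⟩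
      · exact ⟨some c, fun a => by rw [hc]; rfl, fun h => absurd h h0⟩
      · exact ⟨w l, fun a => by rw [hl], fun h => absurd h h0⟩
  choose o ho1 ho2 using key
  obtain ⟨i, hi⟩ := hφ.2 j
  refine ⟨o, ⟨i, ho2 i hi⟩, fun a => ?_⟩
  have := hw a
  rw [Set.mem_preimage] at this
  convert this using 1
  ext i
  rw [ho1]

/-- `D` cannot distinguish the letters `none` and `some a`. -/
def Insens {ι α : Type*} (a : α) (D : Set (ι → Option α)) : Prop :=
  ∀ x y : ι → Option α, (∀ i, (x i).getD a = (y i).getD a) → x ∈ D → y ∈ D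

lemma Insens.preimage {η ι α : Type*} {a : α} {D : Set (ι → Option α)} (hD : Insens a D)
    {φ : (η → Option α) → ι → Option α} (hφ : IsSub φ) : Insens a (φ ⁻¹' D) := by
  intro x y hxy hx
  refine hD _ _ (fun i => ?_) hx
  rcases hφ.1 i with ⟨c, hc⟩ | ⟨j, hj⟩
  · rw [hc, hc]
  · rw [hj, hj, hxy]

lemma Insens.compl {ι α : Type*} {a : α} {D : Set (ι → Option α)} (hD : Insens a D) :
    Insens a Dᶜ := fun x y hxy hx hy => hx (hD y x (fun i => (hxy i).symm) hy)

/-- Words with few letters different from `none` are rare. -/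
lemma rare (α : Type) [Finite α] [Nonempty α] (M : ℕ) {d : ℝ} (hd : 0 < d) :
    ∃ N : ℕ, ∀ (ι : Type) [Finite ι], N ≤ Nat.card ι →
      av (fun x : ι → Option α => ind (Nat.card {i // x i ≠ none} < M)) ≤ d := by
  have := Fintype.ofFinite α
  obtain ⟨k, hk⟩ : ∃ k : ℝ, k = (Fintype.card α : ℝ) := ⟨_, rfl⟩
  have hk1 : 1 ≤ k := by
    rw [hk]; exact_mod_cast Fintype.card_pos
  set q : ℝ := (1 + k / 2) / (k + 1) with hq
  have hq0 : 0 ≤ q := by positivity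
  have hq1 : q < 1 := by
    rw [hq, div_lt_one (by positivity)]; linarith
  obtain ⟨N, hN⟩ := exists_pow_lt_of_lt_one (show 0 < d / 2 ^ M by positivity) hq1
  refine ⟨N, fun ι _ hι => ?_⟩
  have := Fintype.ofFinite ι
  classical
  let g : Option α → ℝ := fun o => o.elim 1 (fun _ => 1 / 2)
  have h1 : av (fun x : ι → Option α => ind (Nat.card {i // x i ≠ none} < M)) ≤
      av (fun x : ι → Option α => 2 ^ M * ∏ i, g (x i)) := by
    apply av_mono
    intro x
    have hg : ∏ i, g (x i) = (1 / 2) ^ (Nat.card {i // x i ≠ none}) := by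
      rw [Nat.card_eq_fintype_card, Fintype.card_subtype, ← Finset.prod_const,
        Finset.prod_filter]
      apply Finset.prod_congr rfl
      intro i _
      rcases h : x i with _ | c <;> simp [g]
    rw [hg]
    by_cases h : Nat.card {i // x i ≠ none} < M
    · rw [ind_true h]
      have : ((1:ℝ) / 2) ^ M ≤ (1 / 2) ^ (Nat.card {i // x i ≠ none}) :=
        pow_le_pow_of_le_one (by norm_num) (by norm_num) h.le
      calc (1:ℝ) = 2 ^ M * (1 / 2) ^ M := by rw [← mul_pow]; norm_num
        _ ≤ _ := by gcongr
    · rw [ind_false h]; positivity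
  have h2 : av (fun x : ι → Option α => ∏ i, g (x i)) = q ^ (Fintype.card ι) := by
    rw [av_eq, ← Fintype.prod_sum (fun (_ : ι) => g)]
    simp [g, Fintype.card_option, hq, div_pow, hk]
    congr 1
  rw [av_mul, h2] at h1
  have h3 : q ^ Fintype.card ι ≤ q ^ N :=
    pow_le_pow_of_le_one hq0 hq1.le (by rwa [Nat.card_eq_fintype_card] at hι)
  rw [lt_div_iff₀ (by positivity)] at hN
  calc _ ≤ 2 ^ M * q ^ Fintype.card ι := h1
    _ ≤ 2 ^ M * q ^ N := by gcongr
    _ ≤ d := by linarith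

/-- Put `none` on `J`, and a word `z` outside. -/
noncomputable def fill {ι α : Type*} (J : Set ι) (z : {i // i ∉ J} → α) : ι → Option α :=
  open Classical in fun i => if h : i ∈ J then none else some (z ⟨i, h⟩)

lemma fill_bij {ι α : Type*} :
    Function.Bijective (fun p : (Σ J : Set ι, ({i // i ∉ J} → α)) => fill p.1 p.2) := by
  constructor
  · rintro ⟨J, z⟩ ⟨J', z'⟩ h
    have hJ : J = J' := by
      ext i
      have := congrFun h i
      simp only [fill] at this
      by_cases h1 : i ∈ J <;> by_cases h2 : i ∈ J' <;> simp_all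
    subst hJ
    congr 1
    ext ⟨i, hi⟩
    have := congrFun h i
    simpa [fill, hi] using this
  · intro x
    refine ⟨⟨{i | x i = none}, fun i => (x i).get (Option.ne_none_iff_isSome.mp i.2)⟩, ?_⟩
    ext1 i
    simp only [fill, Set.mem_ofPred_eq]
    split_ifs with h
    · exact h.symm
    · simp

lemma insens_line (α : Type) [Finite α] (hα : ∀ d, 0 < d → DHJAt α d) (a : α) {d : ℝ}
    (hd : 0 < d) : ∃ N : ℕ, ∀ (ι : Type) [Finite ι], N ≤ Nat.card ι →
      ∀ D : Set (ι → Option α), Insens a D → d ≤ dens D →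
      ∃ φ : (Fin 1 → Option α) → ι → Option α, IsSub φ ∧ ∀ y, φ y ∈ D := by
  have : Nonempty α := ⟨a⟩
  obtain ⟨M, hM⟩ := hα (d / 2) (by positivity)
  obtain ⟨N, hN⟩ := rare α M (d := d / 4) (by positivity)
  refine ⟨N, fun ι _ hι D hD hdD => ?_⟩
  specialize hN ι hι
  by_contra hcon
  have key : ∀ J : Set ι, M ≤ Nat.card {i // i ∉ J} →
      dens {z : {i // i ∉ J} → α | fill J z ∈ D} ≤ d / 2 := by
    intro J hJ
    by_contra! hlt
    obtain ⟨w, ⟨i0, hi0⟩, hw⟩ := hM _ hJ _ hlt.le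
    apply hcon
    classical
    let φ : (Fin 1 → Option α) → ι → Option α := fun y i =>
      if h : i ∈ J then none else (w ⟨i, h⟩).elim (y 0) some
    have hsome : ∀ b, φ (fun _ => some b) ∈ D := by
      intro b
      have := hw b
      rw [Set.mem_ofPred_eq] at this
      convert this using 1
      ext1 i
      simp only [φ, fill]
      split_ifs with h
      · rfl
      · rcases w ⟨i, h⟩ with _ | c <;> rfl
    refine ⟨φ, ⟨fun i => ?_, fun j => ⟨i0, fun y => ?_⟩⟩, fun y => ?_⟩
    · by_cases h : i ∈ J
      · exact Or.inl ⟨none, fun y => by simp [φ, h]⟩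
      · rcases hwi : w ⟨i, h⟩ with _ | c
        · exact Or.inr ⟨0, fun y => by simp [φ, h, hwi]⟩
        · exact Or.inl ⟨some c, fun y => by simp [φ, h, hwi]⟩
    · have : (i0 : ι) ∉ J := i0.2
      have hj : j = 0 := Subsingleton.elim _ _
      simp [φ, this, hi0, hj]
    · refine hD _ _ (fun i => ?_) (hsome ((y 0).getD a))
      simp only [φ]
      split_ifs with h
      · rfl
      · rcases w ⟨i, h⟩ with _ | c <;> simp
  have hsum : dens D ≤ av (fun x : ι → Option α => ind (Nat.card {i // x i ≠ none} < M) + d / 2) := by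
    classical
    have := Fintype.ofFinite ι
    have := Fintype.ofFinite α
    have hfin : ∀ J : Set ι, Fintype {i // i ∉ J} := fun J => Fintype.ofFinite _
    rw [dens, av_eq, av_eq]
    gcongr ?_ / _
    rw [← (Equiv.ofBijective _ (fill_bij (ι := ι) (α := α))).sum_comp,
      ← (Equiv.ofBijective _ (fill_bij (ι := ι) (α := α))).sum_comp, Fintype.sum_sigma,
      Fintype.sum_sigma]
    apply Finset.sum_le_sum
    intro J _
    simp only [Equiv.ofBijective_apply]
    have hJc : ∀ z : {i // i ∉ J} → α, Nat.card {i // fill J z i ≠ none} = Nat.card {i // i ∉ J} := by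
      intro z
      apply Nat.card_congr
      apply Equiv.subtypeEquivRight
      intro i
      by_cases h : i ∈ J <;> simp [fill, h]
    simp only [hJc]
    by_cases h : Nat.card {i // i ∉ J} < M
    · rw [ind_true h]
      apply Finset.sum_le_sum
      intro z _
      have := ind_le_one (fill J z ∈ D)
      linarith
    · have h2 := key J (not_lt.mp h)
      rw [ind_false h, sum_eq_card_mul_av, sum_eq_card_mul_av, av_const]
      gcongr
      rw [zero_add]
      exact h2
  rw [av_add, av_const] at hsum
  linarith

lemma insens_sub (α : Type) [Finite α] (hα : ∀ d, 0 < d → DHJAt α d) (a : α) (m : ℕ) :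
    ∀ {d : ℝ}, 0 < d → ∃ N : ℕ, ∀ (ι : Type) [Finite ι], N ≤ Nat.card ι →
      ∀ D : Set (ι → Option α), Insens a D → d ≤ dens D →
      ∃ φ : (Fin m → Option α) → ι → Option α, IsSub φ ∧ ∀ y, φ y ∈ D := by
  have : Nonempty α := ⟨a⟩
  induction m with
  | zero =>
    intro d hd
    refine ⟨0, fun ι _ _ D hD hdD => ?_⟩
    obtain ⟨x, hx⟩ := exists_le_of_le_av hdD
    have hxD : x ∈ D := by
      by_contra h
      rw [ind_false h] at hx
      linarith
    exact ⟨fun _ => x, ⟨fun i => Or.inl ⟨x i, fun _ => rfl⟩, fun j => j.elim0⟩, fun _ => hxD⟩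
  | succ m ih =>
    intro d hd
    obtain ⟨M, hM⟩ := insens_line α hα a (d := d / 2) (by positivity)
    let W := (Fin 1 → Option α) → Fin M → Option α
    have hW : 0 < Nat.card W := Nat.card_pos
    obtain ⟨N, hN⟩ := ih (d := d / 2 / Nat.card W) (by positivity)
    refine ⟨M + N, fun ι _ hι D hD hdD => ?_⟩
    obtain ⟨r, hr, ⟨e⟩⟩ := exists_split (T := Fin M) (N := N) (by simpa using hι)
    rw [dens, av_glue e, av_comm] at hdD
    have h1 := markov (fun x => av_le fun t => ind_le_one _) hdD hd.le
    obtain ⟨φ, hφ⟩ := pigeon (W := W)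
      (q := fun φ x => IsSub φ ∧ ∀ y, glue e (φ y) x ∈ D) (fun x hx => by
        obtain ⟨φ, h1, h2⟩ := hM (Fin M) (by simp) {t | glue e t x ∈ D}
          (hD.preimage (isSub_glue_left e x)) hx
        exact ⟨φ, h1, h2⟩)
    have h2 : d / 2 / Nat.card W ≤ dens {x | IsSub φ ∧ ∀ y, glue e (φ y) x ∈ D} :=
      le_trans (by gcongr; exact h1) hφ
    obtain ⟨ψ, hψ, hψD⟩ := hN (Fin r) (by simpa using hr) _ (by
      rintro x y hxy ⟨hx1, hx2⟩
      refine ⟨hx1, fun z => ?_⟩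
      exact hD.preimage (isSub_glue_right e (φ z)) x y hxy (hx2 z)) h2
    have hφs : IsSub φ := (hψD (fun _ => none)).1
    refine ⟨fun y => glue e (φ fun _ => y 0) (ψ fun j => y j.succ), ⟨fun i => ?_, fun j => ?_⟩,
      fun y => (hψD _).2 _⟩
    · rcases h : e i with t | x
      · rcases hφs.1 t with ⟨c, hc⟩ | ⟨j, hj⟩
        · exact Or.inl ⟨c, fun y => by simp [glue, h, hc]⟩
        · exact Or.inr ⟨0, fun y => by simp [glue, h, hj]⟩
      · rcases hψ.1 x with ⟨c, hc⟩ | ⟨j, hj⟩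
        · exact Or.inl ⟨c, fun y => by simp [glue, h, hc]⟩
        · exact Or.inr ⟨j.succ, fun y => by simp [glue, h, hj]⟩
    · refine Fin.cases ?_ (fun j => ?_) j
      · obtain ⟨i, hi⟩ := hφs.2 0
        exact ⟨e.symm (Sum.inl i), fun y => by simp [glue, hi]⟩
      · obtain ⟨i, hi⟩ := hψ.2 j
        exact ⟨e.symm (Sum.inr i), fun y => by simp [glue, hi]⟩

/-- All averages of `f` over `m`-dimensional subspaces are nonpositive. -/
def NonposOn {ι β : Type*} [Finite β] (m : ℕ) (f : (ι → β) → ℝ) : Prop :=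
  ∀ φ : (Fin m → β) → ι → β, IsSub φ → av (fun y => f (φ y)) ≤ 0

lemma NonposOn.comp {η ι β : Type*} [Finite β] {m : ℕ} {f : (ι → β) → ℝ} (hf : NonposOn m f)
    {φ : (η → β) → ι → β} (hφ : IsSub φ) : NonposOn m (fun y => f (φ y)) :=
  fun _ hψ => hf _ (hφ.comp hψ)

lemma av_range {X Y : Type*} [Finite X] [Finite Y] [Nonempty Y] {φ : Y → X}
    (hφ : Function.Injective φ) (h : X → ℝ) :
    av (fun x => h x * ind (x ∈ Set.range φ)) = Nat.card Y / Nat.card X * av (fun y => h (φ y)) := by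
  have := Fintype.ofFinite X
  have := Fintype.ofFinite Y
  have h1 : ∑ x, h x * ind (x ∈ Set.range φ) = ∑ y, h (φ y) := by
    classical
    rw [← Finset.sum_image (s := Finset.univ) (f := h) (fun a _ b _ hab => hφ hab),
      ← Finset.sum_subset (Finset.subset_univ (Finset.univ.image φ))]
    · apply Finset.sum_congr rfl
      intro x hx
      rw [ind_true (by simpa using hx), mul_one]
    · intro x _ hx
      rw [ind_false (by simpa using hx), mul_zero]
  rw [av_eq, av_eq, h1]
  simp only [Nat.card_eq_fintype_card]
  field_simp

lemma cover_aux (α : Type) [Finite α] (hα : ∀ d, 0 < d → DHJAt α d) (a : α) (m : ℕ)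
    {η : ℝ} (hη : 0 < η) (hη1 : η ≤ 1) : ∃ c : ℝ, 0 < c ∧ c ≤ 1 ∧ ∀ j : ℕ,
    ∃ N : ℕ, ∀ (ι : Type) [Finite ι], N ≤ Nat.card ι →
      ∀ f : (ι → Option α) → ℝ, (∀ x, f x ≤ 1) → NonposOn m f →
      ∀ D : Set (ι → Option α), Insens a D →
        av (fun x => f x * ind (x ∈ D)) ≤ η + (1 - c) ^ j * dens D := by
  have : Nonempty α := ⟨a⟩
  obtain ⟨M, hM⟩ := insens_sub α hα a m (d := η / 2) (by positivity)
  let W := (Fin m → Option α) → Fin M → Option α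
  have hW : 0 < Nat.card W := Nat.card_pos
  have hX : 0 < Nat.card (Fin M → Option α) := Nat.card_pos
  have hY : 0 < Nat.card (Fin m → Option α) := Nat.card_pos
  have hW1 : (1 : ℝ) ≤ Nat.card W := by exact_mod_cast hW
  have hX1 : (1 : ℝ) ≤ Nat.card (Fin M → Option α) := by exact_mod_cast hX
  have hY1 : (1 : ℝ) ≤ Nat.card (Fin m → Option α) := by exact_mod_cast hY
  obtain ⟨c, hc⟩ : ∃ c, c = η / 2 / Nat.card W * (1 / Nat.card (Fin M → Option α)) := ⟨_, rfl⟩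
  have hc0 : 0 < c := by rw [hc]; positivity
  have hc1 : c ≤ 1 := by
    have h1 : η / 2 / Nat.card W ≤ 1 := by
      rw [div_le_one (by positivity)]; linarith
    have h2 : (1 : ℝ) / Nat.card (Fin M → Option α) ≤ 1 := by
      rw [div_le_one (by positivity)]; exact hX1
    rw [hc]
    exact mul_le_one₀ h1 (by positivity) h2
  refine ⟨c, hc0, hc1, fun j => ?_⟩
  have triv : ∀ (ι : Type) [Finite ι] (f : (ι → Option α) → ℝ), (∀ x, f x ≤ 1) →
      ∀ D : Set (ι → Option α), av (fun x => f x * ind (x ∈ D)) ≤ dens D := by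
    intro ι _ f hf D
    apply av_mono
    intro x
    have := mul_le_mul_of_nonneg_right (hf x) (ind_nonneg (x ∈ D))
    linarith
  induction j with
  | zero =>
    refine ⟨0, fun ι _ _ f hf _ D _ => ?_⟩
    have := triv ι f hf D
    simp only [pow_zero, one_mul]
    linarith
  | succ j ih =>
    obtain ⟨N, hN⟩ := ih
    refine ⟨M + N, fun ι _ hι f hf hfm D hD => ?_⟩
    have hp : 0 ≤ (1 - c) ^ j := pow_nonneg (by linarith) _
    have hp' : 0 ≤ (1 - c) ^ (j + 1) := pow_nonneg (by linarith) _
    by_cases hdD : η ≤ dens D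
    swap
    · have := triv ι f hf D
      have := mul_nonneg hp' (dens_nonneg D)
      linarith
    obtain ⟨r, hr, ⟨e⟩⟩ := exists_split (T := Fin M) (N := N) (by simpa using hι)
    have hdD' := hdD
    rw [dens, av_glue e, av_comm] at hdD'
    have h1 := markov (fun x => av_le fun t => ind_le_one _) hdD' hη.le
    obtain ⟨φ, hφ⟩ := pigeon (W := W)
      (q := fun φ x => IsSub φ ∧ ∀ y, glue e (φ y) x ∈ D) (fun x hx => by
        obtain ⟨φ, h1, h2⟩ := hM (Fin M) (by simp) {t | glue e t x ∈ D}
          (hD.preimage (isSub_glue_left e x)) hx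
        exact ⟨φ, h1, h2⟩)
    have h2 : η / 2 / Nat.card W ≤
        av (fun x => ind (IsSub φ ∧ ∀ y, glue e (φ y) x ∈ D)) :=
      le_trans (by gcongr; exact h1) hφ
    have hφs : IsSub φ := by
      obtain ⟨x, hx⟩ := exists_le_of_le_av h2
      by_contra hcon
      rw [ind_false (fun h => hcon h.1)] at hx
      have : 0 < η / 2 / Nat.card W := by positivity
      linarith
    let E : Set (Fin r → Option α) := {x | ∀ y, glue e (φ y) x ∈ D}
    have hE : η / 2 / Nat.card W ≤ av (fun x => ind (x ∈ E)) :=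
      h2.trans (av_mono fun x => ind_mono fun h => h.2)
    have hEi : Insens a E := fun x y hxy hx z =>
      hD.preimage (isSub_glue_right e (φ z)) x y hxy (hx z)
    let D' : (Fin M → Option α) → Set (Fin r → Option α) := fun t =>
      {x | glue e t x ∈ D ∧ ¬ (t ∈ Set.range φ ∧ x ∈ E)}
    have hD' : ∀ t, Insens a (D' t) := by
      intro t x y hxy hx
      refine ⟨hD.preimage (isSub_glue_right e t) x y hxy hx.1, fun h => hx.2 ⟨h.1, ?_⟩⟩
      exact hEi y x (fun i => (hxy i).symm) h.2
    have hsplit : ∀ t x, ind (glue e t x ∈ D) =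
        ind (x ∈ D' t) + ind (t ∈ Set.range φ) * ind (x ∈ E) := by
      intro t x
      by_cases ht : t ∈ Set.range φ
      · by_cases hx : x ∈ E
        · have hD1 : glue e t x ∈ D := by
            obtain ⟨y, rfl⟩ := ht
            exact hx y
          rw [ind_true ht, ind_true hx, ind_true hD1, ind_false (fun h => h.2 ⟨ht, hx⟩)]
          norm_num
        · rw [ind_false hx, mul_zero, add_zero]
          exact ind_congr ⟨fun h => ⟨h, fun h2 => hx h2.2⟩, fun h => h.1⟩
      · rw [ind_false ht, zero_mul, add_zero]
        exact ind_congr ⟨fun h => ⟨h, fun h2 => ht h2.1⟩, fun h => h.1⟩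
    have hmain : av (fun x => f x * ind (x ∈ D)) =
        av (fun t => av fun x => f (glue e t x) * ind (x ∈ D' t)) +
        av (fun x => ind (x ∈ E) * av fun t => f (glue e t x) * ind (t ∈ Set.range φ)) := by
      rw [av_glue e]
      simp only [← av_mul]
      rw [av_comm (fun x t => ind (x ∈ E) * (f (glue e t x) * ind (t ∈ Set.range φ))), ← av_add]
      apply av_congr
      intro t
      rw [← av_add]
      apply av_congr
      intro x
      rw [hsplit]
      ring
    have hsecond :
        av (fun x => ind (x ∈ E) * av fun t => f (glue e t x) * ind (t ∈ Set.range φ)) ≤ 0 := by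
      apply av_le
      intro x
      apply mul_nonpos_of_nonneg_of_nonpos (ind_nonneg _)
      rw [av_range hφs.injective (fun t => f (glue e t x))]
      apply mul_nonpos_of_nonneg_of_nonpos (by positivity)
      exact hfm _ ((isSub_glue_left e x).comp hφs)
    have hdens : dens D = av (fun t => dens (D' t)) +
        av (fun x => ind (x ∈ E)) * av (fun t => ind (t ∈ Set.range φ)) := by
      rw [dens, av_glue e, ← av_mul, ← av_add]
      apply av_congr
      intro t
      rw [dens, mul_comm, ← av_mul, ← av_add]
      apply av_congr
      intro x
      exact hsplit t x
    have hrange : 1 / Nat.card (Fin M → Option α) ≤ av (fun t => ind (t ∈ Set.range φ)) := by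
      have := av_range hφs.injective (fun _ => 1)
      simp only [one_mul, av_const, mul_one] at this
      rw [this]
      gcongr
    have hcE : c ≤ av (fun x => ind (x ∈ E)) * av (fun t => ind (t ∈ Set.range φ)) := by
      rw [hc]
      gcongr
      exact av_nonneg fun _ => ind_nonneg _
    have hfirst : av (fun t => av fun x => f (glue e t x) * ind (x ∈ D' t)) ≤
        η + (1 - c) ^ j * av (fun t => dens (D' t)) := by
      have hrw : η + (1 - c) ^ j * av (fun t => dens (D' t)) =
          av (fun t => η + (1 - c) ^ j * dens (D' t)) := by rw [av_add, av_const, av_mul]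
      rw [hrw]
      apply av_mono
      intro t
      exact hN (Fin r) (by simpa using hr) _ (fun x => hf _) (hfm.comp (isSub_glue_right e t)) _
        (hD' t)
    have hle : av (fun t => dens (D' t)) ≤ (1 - c) * dens D := by
      have : dens D ≤ 1 := dens_le_one D
      nlinarith
    have := mul_le_mul_of_nonneg_left hle hp
    rw [hmain, pow_succ]
    linarith

lemma cover (α : Type) [Finite α] (hα : ∀ d, 0 < d → DHJAt α d) (a : α) (m : ℕ)
    {η : ℝ} (hη : 0 < η) :
    ∃ N : ℕ, ∀ (ι : Type) [Finite ι], N ≤ Nat.card ι →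
      ∀ f : (ι → Option α) → ℝ, (∀ x, f x ≤ 1) → NonposOn m f →
      ∀ D : Set (ι → Option α), Insens a D → av (fun x => f x * ind (x ∈ D)) ≤ η := by
  obtain ⟨c, hc0, hc1, H⟩ := cover_aux α hα a m (η := min (η / 2) 1) (by positivity)
    (min_le_right _ _)
  obtain ⟨j, hj⟩ := exists_pow_lt_of_lt_one (show 0 < η / 2 by positivity)
    (show 1 - c < 1 by linarith)
  obtain ⟨N, hN⟩ := H j
  refine ⟨N, fun ι _ hι f hf hfm D hD => (hN ι hι f hf hfm D hD).trans ?_⟩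
  have h1 : (1 - c) ^ j * dens D ≤ (1 - c) ^ j * 1 :=
    mul_le_mul_of_nonneg_left (dens_le_one D) (pow_nonneg (by linarith) _)
  have := min_le_left (η / 2) 1
  linarith

lemma cover_union (α : Type) [Finite α] (hα : ∀ d, 0 < d → DHJAt α d) (S : Finset α) :
    ∀ (m : ℕ) {η : ℝ}, 0 < η →
    ∃ N : ℕ, ∀ (ι : Type) [Finite ι], N ≤ Nat.card ι →
      ∀ f : (ι → Option α) → ℝ, (∀ x, f x ≤ 1) → NonposOn m f →
      ∀ C : α → Set (ι → Option α), (∀ a, Insens a (C a)) →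
        av (fun x => f x * ind (∃ a ∈ S, x ∉ C a)) ≤ η := by
  classical
  induction S using Finset.induction_on with
  | empty =>
    intro m η hη
    refine ⟨0, fun ι _ _ f _ _ C _ => av_le fun x => ?_⟩
    rw [ind_false (by simp)]
    linarith
  | insert a S ha ih =>
    intro m η hη
    obtain ⟨m1, hm1⟩ := ih m (η := η / 3) (by positivity)
    obtain ⟨N1, hN1⟩ := cover α hα a m1 (η := η / 3) (by positivity)
    obtain ⟨N2, hN2⟩ := cover α hα a m (η := η / 3) (by positivity)
    refine ⟨max N1 N2, fun ι _ hι f hf hfm C hC => ?_⟩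
    have h1 := hN1 ι ((le_max_left _ _).trans hι)
      (fun x => f x * ind (∃ a ∈ S, x ∉ C a) - η / 3) (fun x => by
        have := ind_nonneg (∃ a ∈ S, x ∉ C a)
        have h2 := ind_le_one (∃ a ∈ S, x ∉ C a)
        have := mul_le_mul_of_nonneg_right (hf x) this
        linarith) (fun φ hφ => by
        rw [av_sub, av_const]
        have := hm1 (Fin m1) (by simp) (fun y => f (φ y)) (fun y => hf _) (hfm.comp hφ)
          (fun a => φ ⁻¹' (C a)) (fun a => (hC a).preimage hφ)
        simp only [Set.mem_preimage] at this
        linarith) (C a) (hC a)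
    have h2 := hN2 ι ((le_max_right _ _).trans hι) f hf hfm (C a)ᶜ (hC a).compl
    have h3 : av (fun x => f x * ind (∃ b ∈ insert a S, x ∉ C b)) ≤
        av (fun x => ((f x * ind (∃ a ∈ S, x ∉ C a) - η / 3) * ind (x ∈ C a) +
          f x * ind (x ∈ (C a)ᶜ)) + η / 3) := by
      apply av_mono
      intro x
      by_cases hx : x ∈ C a
      · rw [ind_true hx, ind_false (p := x ∈ (C a)ᶜ) (fun h => h hx),
          ind_congr (q := ∃ a ∈ S, x ∉ C a)]
        · linarith
        · simp [hx]
      · rw [ind_false hx, ind_true (p := x ∈ (C a)ᶜ) hx,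
          ind_true (p := ∃ b ∈ insert a S, x ∉ C b) ⟨a, by simp, hx⟩]
        linarith
    rw [av_add, av_add, av_const] at h3
    linarith

/-- Regularity: all sections over a block can be assumed to be dense. -/
lemma regular (β : Type) [Finite β] [Nonempty β] (T : Type) [Finite T] {ε : ℝ} (hε : 0 < ε) :
    ∃ N : ℕ, ∀ (ι : Type) [Finite ι], N ≤ Nat.card ι → ∀ A : Set (ι → β),
      ∃ (r : ℕ) (φ : (T ⊕ Fin r → β) → ι → β), IsSub φ ∧
        ∀ t : T → β, dens A - ε ≤ av (fun x : Fin r → β => ind (φ (Sum.elim t x) ∈ A)) := by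
  have hK : 0 < Nat.card (T → β) := Nat.card_pos
  obtain ⟨c, hc⟩ : ∃ c : ℝ, c = ε / Nat.card (T → β) := ⟨_, rfl⟩
  have hc0 : 0 < c := by rw [hc]; positivity
  have main : ∀ j : ℕ, ∃ N : ℕ, ∀ (ι : Type) [Finite ι], N ≤ Nat.card ι → ∀ A : Set (ι → β),
      1 - j * c < dens A → ∃ (r : ℕ) (φ : (T ⊕ Fin r → β) → ι → β), IsSub φ ∧
        ∀ t : T → β, dens A - ε ≤ av (fun x : Fin r → β => ind (φ (Sum.elim t x) ∈ A)) := by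
    intro j
    induction j with
    | zero =>
      refine ⟨0, fun ι _ _ A hA => ?_⟩
      have := dens_le_one A
      simp at hA
      linarith
    | succ j ih =>
      obtain ⟨N, hN⟩ := ih
      refine ⟨Nat.card T + N, fun ι _ hι A hA => ?_⟩
      obtain ⟨r, hr, ⟨e⟩⟩ := exists_split hι
      by_cases hgood : ∀ t : T → β, dens A - ε ≤ dens {x : Fin r → β | glue e t x ∈ A}
      · refine ⟨r, fun z i => z (e i), ⟨fun i => Or.inr ⟨e i, fun _ => rfl⟩,
          fun j => ⟨e.symm j, fun y => by simp⟩⟩, hgood⟩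
      · push Not at hgood
        obtain ⟨t, ht⟩ := hgood
        obtain ⟨t', ht'⟩ : ∃ t' : T → β, dens A + c ≤ dens {x : Fin r → β | glue e t' x ∈ A} := by
          by_contra! hcon
          have h1 : dens A = av (fun t => dens {x : Fin r → β | glue e t x ∈ A}) := by
            rw [dens, av_glue e]; rfl
          have h2 : av (fun s => dens {x : Fin r → β | glue e s x ∈ A}) ≤
              av (fun s => dens A + c - (ε + c) * ind (s = t)) := by
            apply av_mono
            intro s
            by_cases hs : s = t
            · rw [ind_true hs, hs]; linarith
            · rw [ind_false hs]; linarith [hcon s]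
          have h3 : av (fun s : T → β => ind (s = t)) = 1 / Nat.card (T → β) := by
            classical
            have := Fintype.ofFinite T
            have := Fintype.ofFinite β
            rw [av_eq, Nat.card_eq_fintype_card, Finset.sum_eq_single t, ind_true rfl]
            · intro s _ hs
              exact ind_false hs
            · simp
          rw [av_sub, av_mul, av_const, h3, ← h1] at h2
          have h4 : (ε + c) * (1 / Nat.card (T → β)) = c + c * (1 / Nat.card (T → β)) := by
            rw [hc]; ring
          have : 0 < c * (1 / Nat.card (T → β)) := by positivity
          linarith
        obtain ⟨r', φ, hφ, hφA⟩ := hN (Fin r) (by simpa using hr) {x | glue e t' x ∈ A} (by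
          push_cast at hA; linarith)
        refine ⟨r', _, (isSub_glue_right e t').comp hφ, fun s => ?_⟩
        have := hφA s
        exact le_trans (by linarith) this
  obtain ⟨j, hj⟩ := exists_nat_gt (1 / c)
  obtain ⟨N, hN⟩ := main j
  refine ⟨N, fun ι _ hι A => hN ι hι A ?_⟩
  rw [div_lt_iff₀ hc0] at hj
  linarith [dens_nonneg A]

lemma rare_none (α : Type) [Finite α] {d : ℝ} (hd : 0 < d) :
    ∃ N : ℕ, ∀ (ι : Type) [Finite ι], N ≤ Nat.card ι →
      av (fun x : ι → Option α => ind (∀ i, x i ≠ none)) ≤ d := by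
  have := Fintype.ofFinite α
  obtain ⟨k, hk⟩ : ∃ k : ℝ, k = (Fintype.card α : ℝ) := ⟨_, rfl⟩
  have hk0 : 0 ≤ k := by rw [hk]; positivity
  obtain ⟨q, hq⟩ : ∃ q : ℝ, q = k / (k + 1) := ⟨_, rfl⟩
  have hq0 : 0 ≤ q := by rw [hq]; positivity
  have hq1 : q < 1 := by
    rw [hq, div_lt_one (by positivity)]; linarith
  obtain ⟨N, hN⟩ := exists_pow_lt_of_lt_one hd hq1
  refine ⟨N, fun ι _ hι => ?_⟩
  have := Fintype.ofFinite ι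
  classical
  let g : Option α → ℝ := fun o => o.elim 0 (fun _ => 1)
  have h1 : av (fun x : ι → Option α => ind (∀ i, x i ≠ none)) ≤
      av (fun x : ι → Option α => ∏ i, g (x i)) := by
    apply av_mono
    intro x
    have hg0 : ∀ o, 0 ≤ g o := by
      intro o
      rcases o with _ | c <;> simp [g]
    by_cases h : ∀ i, x i ≠ none
    · rw [ind_true h, Finset.prod_eq_one]
      intro i _
      obtain ⟨c, hc⟩ := Option.ne_none_iff_exists'.mp (h i)
      simp [g, hc]
    · rw [ind_false h]
      exact Finset.prod_nonneg fun i _ => hg0 _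
  have h2 : av (fun x : ι → Option α => ∏ i, g (x i)) = q ^ (Fintype.card ι) := by
    rw [av_eq, ← Fintype.prod_sum (fun (_ : ι) => g)]
    simp [g, Fintype.card_option, hq, div_pow, hk]
  have h3 : q ^ Fintype.card ι ≤ q ^ N :=
    pow_le_pow_of_le_one hq0 hq1.le (by rwa [Nat.card_eq_fintype_card] at hι)
  linarith

/-- Replace the letter `none` by `some a`. -/
def rep {ι α : Type*} (a : α) (y : ι → Option α) : ι → Option α := fun i => some ((y i).getD a)

lemma core (α : Type) [Finite α] (hα : ∀ d, 0 < d → DHJAt α d) (m : ℕ) {ε : ℝ} (hε : 0 < ε) :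
    ∃ N : ℕ, ∀ (κ : Type) [Finite κ], N ≤ Nat.card κ → ∀ A : Set (κ → Option α), ¬ HasLine A →
      ∀ b : ℝ, 0 ≤ b → NonposOn m (fun y : κ → Option α => ind (y ∈ A) - b) →
      dens A + b * dens {y : κ → Option α | ∀ a, rep a y ∈ A} ≤ b + 2 * ε := by
  have := Fintype.ofFinite α
  obtain ⟨N1, hN1⟩ := cover_union α hα Finset.univ m hε
  obtain ⟨N2, hN2⟩ := rare_none α hε
  refine ⟨max N1 N2, fun κ _ hκ A hA b hb hm => ?_⟩
  have h1 := hN1 κ ((le_max_left _ _).trans hκ) (fun y => ind (y ∈ A) - b)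
    (fun y => by linarith [ind_le_one (y ∈ A)]) hm (fun a => {y | rep a y ∈ A}) (by
      intro a x y hxy hx
      have : rep a x = rep a y := by
        ext1 i
        simp only [rep, hxy]
      rw [Set.mem_ofPred_eq] at hx ⊢
      rwa [← this])
  have h2 := hN2 κ ((le_max_right _ _).trans hκ)
  have h3 : av (fun y : κ → Option α => ind (y ∈ A) + b * ind (∀ a, rep a y ∈ A)) ≤
      av (fun y : κ → Option α => ((ind (y ∈ A) - b) *
        ind (∃ a ∈ Finset.univ, y ∉ {y : κ → Option α | rep a y ∈ A}) + ind (∀ i, y i ≠ none))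
        + b) := by
    apply av_mono
    intro y
    by_cases hy : ∀ a, rep a y ∈ A
    · rw [ind_true hy, ind_false (p := ∃ a ∈ Finset.univ, y ∉ {y : κ → Option α | rep a y ∈ A})
        (by rintro ⟨a, -, ha⟩; exact ha (hy a))]
      have : ind (y ∈ A) ≤ ind (∀ i, y i ≠ none) := by
        apply ind_mono
        intro hyA
        by_contra! hcon
        apply hA
        refine ⟨fun i => (y i).map some, ?_, ?_⟩
        · obtain ⟨i, hi⟩ := hcon
          exact ⟨i, by simp [hi]⟩
        · intro o
          rcases o with _ | a
          · convert hyA using 1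
            ext1 i
            show ((y i).map some).getD none = y i
            rcases y i with _ | c <;> rfl
          · convert hy a using 1
            ext1 i
            simp only [rep]
            rcases y i with _ | c <;> rfl
      linarith
    · rw [ind_false hy, ind_true (p := ∃ a ∈ Finset.univ, y ∉ {y : κ → Option α | rep a y ∈ A})
        (by push Not at hy; obtain ⟨a, ha⟩ := hy; exact ⟨a, Finset.mem_univ a, ha⟩)]
      linarith [ind_nonneg (∀ i, y i ≠ none)]
  rw [av_add, av_add, av_add, av_mul, av_const] at h3
  change dens A + b * dens {y : κ → Option α | ∀ a, rep a y ∈ A} ≤ _ at h3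
  linarith

lemma step (α : Type) [Finite α] [Nonempty α] (hα : ∀ d, 0 < d → DHJAt α d) :
    ∀ d, 0 < d → DHJAt (Option α) d := by
  let G : Set ℝ := {d | 0 < d ∧ DHJAt (Option α) d}
  have hG2 : (2 : ℝ) ∈ G := by
    refine ⟨by norm_num, 0, fun ι _ _ A hA => ?_⟩
    linarith [dens_le_one A]
  have hmono : ∀ d d', d ≤ d' → DHJAt (Option α) d → DHJAt (Option α) d' := by
    rintro d d' hdd ⟨N, hN⟩
    exact ⟨N, fun ι _ hι A hA => hN ι hι A (hdd.trans hA)⟩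
  have hbdd : BddBelow G := ⟨0, fun d hd => hd.1.le⟩
  obtain ⟨D, hD⟩ : ∃ D, D = sInf G := ⟨_, rfl⟩
  have hD0 : 0 ≤ D := by rw [hD]; exact le_csInf ⟨2, hG2⟩ fun d hd => hd.1.le
  have hup : ∀ d, D < d → DHJAt (Option α) d := by
    intro d hd
    rw [hD] at hd
    obtain ⟨d', hd', hlt⟩ := exists_lt_of_csInf_lt ⟨2, hG2⟩ hd
    exact hmono d' d hlt.le hd'.2
  have hdown : ∀ d, 0 < d → d < D → ¬ DHJAt (Option α) d := by
    intro d hd0 hd h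
    have : D ≤ d := by rw [hD]; exact csInf_le hbdd ⟨hd0, h⟩
    linarith
  rcases hD0.eq_or_lt with h0 | hDpos
  · intro d hd
    exact hup d (by rwa [← h0])
  exfalso
  -- parameters
  obtain ⟨M, hM⟩ := hα (D / 4) (by positivity)
  let W := Fin M → Option α
  have hW : 0 < Nat.card W := Nat.card_pos
  have hW1 : (1 : ℝ) ≤ Nat.card W := by exact_mod_cast hW
  obtain ⟨θ, hθ⟩ : ∃ θ, θ = D / 4 / Nat.card W := ⟨_, rfl⟩
  have hθ0 : 0 < θ := by rw [hθ]; positivity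
  obtain ⟨ε, hεdef⟩ : ∃ ε, ε = min (D / 8) (D * θ / 8) := ⟨_, rfl⟩
  have hε : 0 < ε := by rw [hεdef]; positivity
  have hε1 : ε ≤ D / 8 := by rw [hεdef]; exact min_le_left _ _
  have hε2 : ε ≤ D * θ / 8 := by rw [hεdef]; exact min_le_right _ _
  obtain ⟨N0, hN0⟩ := hup (D + ε) (by linarith)
  obtain ⟨m, hm⟩ := core α hα N0 hε
  let T := Fin M × Fin m
  obtain ⟨N, hN⟩ := regular (Option α) T hε
  have hnot := hdown (D - ε) (by linarith) (by linarith)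
  unfold DHJAt at hnot
  push Not at hnot
  obtain ⟨ι, hfin, hι, A₀, hA₀, hA₀line⟩ := hnot N
  obtain ⟨r, φ, hφ, hφA⟩ := hN ι hι A₀
  let A : Set (T ⊕ Fin r → Option α) := φ ⁻¹' A₀
  have hA : ¬ HasLine A := fun h => hA₀line (h.of_sub hφ)
  have hsec : ∀ t : T → Option α, D - 2 * ε ≤
      av (fun x : Fin r → Option α => ind (Sum.elim t x ∈ A)) := by
    intro t
    have := hφA t
    exact le_trans (by linarith) this
  -- find a good line
  let s : (T → Option α) → (Fin M → α) → T → Option α := fun b z i => some ((b i).getD (z i.1))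
  obtain ⟨w, hw⟩ : ∃ w : W, θ ≤ av (fun p : (T → Option α) × (Fin r → Option α) =>
      ind ((∃ h, w h = none) ∧ ∀ a, Sum.elim (s p.1 fun h => (w h).getD a) p.2 ∈ A)) := by
    have h1 : D / 2 ≤ av (fun p : (T → Option α) × (Fin r → Option α) =>
        dens {z : Fin M → α | Sum.elim (s p.1 z) p.2 ∈ A}) := by
      rw [av_prod]
      apply le_av
      intro b
      simp only [dens]
      rw [av_comm]
      apply le_av
      intro z
      exact le_trans (by linarith) (hsec (s b z))
    have h2 := markov (fun p => dens_le_one _) h1 (by positivity)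
    obtain ⟨w, hw⟩ := pigeon (W := W)
      (q := fun w (p : (T → Option α) × (Fin r → Option α)) => (∃ h, w h = none) ∧
        ∀ a, Sum.elim (s p.1 fun h => (w h).getD a) p.2 ∈ A)
      (p := fun p => D / 2 / 2 ≤ dens {z : Fin M → α | Sum.elim (s p.1 z) p.2 ∈ A}) (fun p hp => by
        obtain ⟨w, hw1, hw2⟩ := hM (Fin M) (by simp) _ (le_trans (by linarith) hp)
        exact ⟨w, hw1, hw2⟩)
    refine ⟨w, le_trans ?_ hw⟩
    rw [hθ]
    gcongr
    linarith
  obtain ⟨h₀, hh₀⟩ : ∃ h, w h = none := by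
    obtain ⟨p, hp⟩ := exists_le_of_le_av hw
    by_contra hcon
    rw [ind_false fun h => hcon h.1] at hp
    linarith
  let κ := {i : T // w i.1 = none}
  let κ' := {i : T // ¬ w i.1 = none}
  have hκ : m ≤ Nat.card κ := by
    have : Function.Injective (fun j : Fin m => (⟨(h₀, j), hh₀⟩ : κ)) := by
      intro j j' h
      exact congrArg (fun q : κ => q.1.2) h
    simpa using Nat.card_le_card_of_injective _ this
  classical
  let e : T ≃ κ ⊕ κ' := (Equiv.sumCompl (fun i : T => w i.1 = none)).symm
  have he1 : ∀ (i : T) (h : w i.1 = none), e i = Sum.inl ⟨i, h⟩ := fun i h => by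
    exact (Equiv.symm_apply_eq _).mpr rfl
  have he2 : ∀ (i : T) (h : ¬ w i.1 = none), e i = Sum.inr ⟨i, h⟩ := fun i h => by
    exact (Equiv.symm_apply_eq _).mpr rfl
  obtain ⟨a₀⟩ := ‹Nonempty α›
  -- the subspaces
  let t' : (κ' → Option α) → κ' → Option α := fun b i => some ((b i).getD ((w i.1.1).getD a₀))
  let V : (κ' → Option α) → (Fin r → Option α) → (κ → Option α) → T ⊕ Fin r → Option α :=
    fun b x y => Sum.elim (glue e y (t' b)) x
  have hV : ∀ b x, IsSub (V b x) := by
    intro b x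
    exact (isSub_glue_left (Equiv.refl (T ⊕ Fin r)) x).comp (isSub_glue_left e (t' b))
  have hVrep : ∀ b x y a, V b x (rep a y) =
      Sum.elim (s (glue e y b) fun h => (w h).getD a) x := by
    intro b x y a
    ext1 i
    rcases i with i | i
    · simp only [V, Sum.elim_inl, s, glue]
      by_cases hi : w i.1 = none
      · rw [he1 i hi]; simp [rep, hi]
      · rw [he2 i hi]
        obtain ⟨c, hc⟩ := Option.ne_none_iff_exists'.mp hi
        simp [t', hc]
    · rfl
  have hcore : ∀ b x, dens (V b x ⁻¹' A) + (D + ε) * dens {y | ∀ a, rep a y ∈ V b x ⁻¹' A} ≤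
      (D + ε) + 2 * ε := by
    intro b x
    apply hm κ hκ _ (fun h => hA (h.of_sub (hV b x))) (D + ε) (by linarith)
    intro ψ hψ
    rw [av_sub, av_const]
    by_contra! hcon
    apply hA
    apply HasLine.of_sub ((hV b x).comp hψ)
    apply hN0 (Fin N0) (by simp)
    have : dens ((fun y => V b x (ψ y)) ⁻¹' A) = av (fun y => ind (ψ y ∈ V b x ⁻¹' A)) := rfl
    linarith
  have hsum : av (fun b => av fun x => dens (V b x ⁻¹' A) +
      (D + ε) * dens {y | ∀ a, rep a y ∈ V b x ⁻¹' A}) ≤ (D + ε) + 2 * ε :=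
    av_le fun b => av_le fun x => hcore b x
  simp only [av_add, av_mul] at hsum
  have hX : D - 2 * ε ≤ av (fun b => av fun x => dens (V b x ⁻¹' A)) := by
    apply le_av
    intro b
    simp only [dens]
    rw [av_comm]
    apply le_av
    intro y
    exact hsec (glue e y (t' b))
  have hY : θ ≤ av (fun b => av fun x => dens {y | ∀ a, rep a y ∈ V b x ⁻¹' A}) := by
    refine hw.trans ?_
    rw [av_prod, av_glue e, av_comm]
    apply av_mono
    intro b
    simp only [dens]
    rw [av_comm]
    apply av_mono
    intro x
    apply av_mono
    intro y
    apply ind_mono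
    rintro ⟨-, h⟩ a
    rw [Set.mem_preimage, hVrep]
    exact h a
  have : (D + ε) * θ ≤ (D + ε) * av (fun b => av fun x => dens {y | ∀ a, rep a y ∈ V b x ⁻¹' A}) :=
    mul_le_mul_of_nonneg_left hY (by linarith)
  have h5 : 0 < ε * θ := by positivity
  have h6 : 0 < D * θ := by positivity
  linarith

/-- The density Hales-Jewett theorem. -/
theorem dhj (α : Type) [Finite α] : ∀ d, 0 < d → DHJAt α d := by
  have main : ∀ (α : Type) [Finite α], ∀ (_ : Finite α) d, 0 < d → DHJAt α d := by
    intro α _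
    refine Finite.induction_empty_option (P := fun α => ∀ (_ : Finite α) d, 0 < d → DHJAt α d)
      ?_ ?_ ?_ α
    · intro α β e h hβ d hd
      have hα : Finite α := Finite.of_equiv β e.symm
      obtain ⟨N, hN⟩ := h hα d hd
      refine ⟨N, fun ι _ hι A hA => ?_⟩
      obtain ⟨w, ⟨i, hi⟩, hw⟩ := hN ι hι {x | (fun i => e (x i)) ∈ A} (by
        refine hA.trans_eq ?_
        exact (av_equiv (Equiv.piCongrRight fun _ : ι => e) (fun x => ind (x ∈ A))).symm)
      refine ⟨fun i => (w i).map e, ⟨i, by simp [hi]⟩, fun b => ?_⟩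
      have := hw (e.symm b)
      rw [Set.mem_ofPred_eq] at this
      convert this using 1
      ext1 i
      show ((w i).map e).getD b = e ((w i).getD (e.symm b))
      rcases w i with _ | c <;> simp
    · intro _ d hd
      refine ⟨1, fun ι _ hι A hA => ⟨fun _ => none, ?_, fun a => a.elim⟩⟩
      have : Nonempty ι := (Nat.card_pos_iff.mp hι).1
      exact ⟨Classical.arbitrary ι, rfl⟩
    · intro α _ h hα'
      have hα : Finite α := inferInstance
      rcases isEmpty_or_nonempty α with he | he
      · intro d hd
        refine ⟨1, fun ι _ hι A hA => ⟨fun _ => none, ?_, fun a => ?_⟩⟩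
        · have : Nonempty ι := (Nat.card_pos_iff.mp hι).1
          exact ⟨Classical.arbitrary ι, rfl⟩
        · obtain ⟨x, hx⟩ := exists_le_of_le_av hA
          have hxA : x ∈ A := by
            by_contra hcon
            rw [ind_false hcon] at hx
            linarith
          convert hxA using 1
          ext1 i
          exact Subsingleton.elim _ _
      · exact step α (h hα)
  exact main α inferInstance

end DHJ

lemma folner_count (F : Finset ℚ) (A : Set ℚ) (s : ℚ) (hF : F.Nonempty) :
    (Set.ncard (A ∩ ↑F) : ℝ) / F.card - (((F.image (s + ·)) ∆ F).card : ℝ) / F.card ≤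
      DHJ.av (fun g : F => DHJ.ind (s + (g : ℚ) ∈ A)) := by
  classical
  have hc : (0 : ℝ) < F.card := by exact_mod_cast hF.card_pos
  rw [DHJ.av_eq, ← sub_div, Fintype.card_coe]
  refine div_le_div_of_nonneg_right ?_ hc.le
  have h1 : ∑ g : F, DHJ.ind (s + (g : ℚ) ∈ A) = ((F.filter fun g => s + g ∈ A).card : ℝ) := by
    rw [Finset.sum_coe_sort F (fun g => DHJ.ind (s + g ∈ A)), Finset.card_filter]
    push_cast
    refine Finset.sum_congr rfl fun g _ => ?_
    by_cases h : s + g ∈ A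
    · rw [DHJ.ind_true h, if_pos h]
    · rw [DHJ.ind_false h, if_neg h]
  rw [h1, sub_le_iff_le_add]
  have h2 : (A ∩ ↑F : Set ℚ) = ↑(F.filter fun a => a ∈ A) := by
    ext a
    simp [and_comm]
  rw [h2, Set.ncard_coe_finset]
  have h3 : (F.filter fun a => a ∈ A) ⊆
      ((F.filter fun g => s + g ∈ A).image (s + ·)) ∪ ((F.image (s + ·)) ∆ F) := by
    intro a ha
    rw [Finset.mem_filter] at ha
    rw [Finset.mem_union]
    by_cases h : a ∈ F.image (s + ·)
    · left
      obtain ⟨g, hg, rfl⟩ := Finset.mem_image.mp h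
      exact Finset.mem_image_of_mem _ (Finset.mem_filter.mpr ⟨hg, ha.2⟩)
    · right
      exact Finset.mem_symmDiff.mpr (Or.inr ⟨ha.1, h⟩)
  have h4 := (Finset.card_le_card h3).trans (Finset.card_union_le _ _)
  have h5 := Finset.card_image_le (s := F.filter fun g => s + g ∈ A) (f := (s + ·))
  exact_mod_cast h4.trans (Nat.add_le_add_right h5 _)

/-- If `A ⊆ ℚ` has positive upper density along a left Følner sequence, then `A` contains
arithmetic progressions of every finite length: for each `k` there are a nonzero integer
`q` and `p ∈ A` with `p + jq ∈ A` for all `0 ≤ j ≤ k`. -/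
theorem density_arithmetic_progressions_integer (F : ℕ → Finset ℚ) (hF : IsLeftFolner F)
    (A : Set ℚ) (hA : 0 < upperDensity F A) (k : ℕ) :
    ∃ q : ℤ, q ≠ 0 ∧ ∃ p ∈ A, ∀ j : ℕ, j ≤ k → p + (j : ℚ) * (q : ℚ) ∈ A := by
  classical
  obtain ⟨hne, hfol⟩ := hF
  set d := upperDensity F A with hd
  obtain ⟨N, hN⟩ := DHJ.dhj (Fin (k + 1)) (d / 4) (by positivity)
  let Φ : (Fin N → Fin (k + 1)) → ℚ := fun x => ∑ i, ((x i : ℕ) : ℚ)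
  have hfreq : ∃ᶠ n in Filter.atTop,
      d / 2 < (Set.ncard (A ∩ ↑(F n)) : ℝ) / (F n).card := by
    refine Filter.frequently_lt_of_lt_limsup ?_ ?_
    · refine Filter.IsBoundedUnder.isCoboundedUnder_le ⟨0, ?_⟩
      exact Filter.eventually_map.mpr <| Filter.Eventually.of_forall fun n =>
        div_nonneg (Nat.cast_nonneg _) (Nat.cast_nonneg _)
    · change d / 2 < d
      linarith
  have hev : ∀ᶠ n in Filter.atTop, ∀ x : Fin N → Fin (k + 1),
      ((((F n).image (Φ x + ·)) ∆ (F n)).card : ℝ) / (F n).card < d / 4 := by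
    rw [Filter.eventually_all]
    intro x
    exact (hfol (Φ x)).eventually_lt_const (by positivity)
  obtain ⟨n, hn1, hn2⟩ := (hfreq.and_eventually hev).exists
  have : Nonempty (F n) := (hne n).to_subtype
  have h1 : d / 4 ≤ DHJ.av (fun x : Fin N → Fin (k + 1) =>
      DHJ.av fun g : F n => DHJ.ind (Φ x + (g : ℚ) ∈ A)) := by
    refine DHJ.le_av fun x => ?_
    have := folner_count (F n) A (Φ x) (hne n)
    have := hn2 x
    linarith
  rw [DHJ.av_comm] at h1
  obtain ⟨g, hg⟩ := DHJ.exists_le_of_le_av h1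
  obtain ⟨w, ⟨i₀, hi₀⟩, hw⟩ := hN (Fin N) (by simp) {x | Φ x + (g : ℚ) ∈ A} hg
  let S : Finset (Fin N) := Finset.univ.filter fun i => w i = none
  have hS : i₀ ∈ S := Finset.mem_filter.mpr ⟨Finset.mem_univ _, hi₀⟩
  have hcard : S.card ≠ 0 := Finset.card_ne_zero_of_mem hS
  let p : ℚ := Φ (fun i => (w i).getD 0) + (g : ℚ)
  have key : ∀ a : Fin (k + 1), Φ (fun i => (w i).getD a) + (g : ℚ)
      = p + ((a : ℕ) : ℚ) * ((S.card : ℤ) : ℚ) := by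
    intro a
    have : Φ (fun i => (w i).getD a) = Φ (fun i => (w i).getD 0) + ((a : ℕ) : ℚ) * (S.card : ℚ) := by
      have hc : (S.card : ℚ) = ∑ i, if w i = none then (1 : ℚ) else 0 := by
        rw [Finset.card_filter]
        push_cast
        rfl
      rw [hc, Finset.mul_sum]
      simp only [Φ]
      rw [← Finset.sum_add_distrib]
      refine Finset.sum_congr rfl fun i _ => ?_
      rcases w i with _ | c <;> simp
    rw [this]
    simp only [p]
    push_cast
    ring
  refine ⟨(S.card : ℤ), by exact_mod_cast hcard, p, hw 0, fun j hj => ?_⟩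
  have h2 := hw ⟨j, Nat.lt_succ_of_le hj⟩
  rw [Set.mem_ofPred_eq, key] at h2
  exact h2
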